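/- For every rotation R of S there is exactly one index j ∈ [1,n] such that: (1) the prefix R[1..j] has a unique Weiner link; (2) for every i with 1 ≤ i < j, the prefix R[1..i] has at least two Weiner links; and (3) every string y' that is a prefix of some rotation of S and has R[1..j] as a prefix has a unique Weiner link. -/

import Mathlib

noncomputable section
open scoped Classical

variable {α : Type*} [LinearOrder α]

/-- The `i`-th rotation (0-indexed) of the string `S`. -/
def rot (S : List α) (i : ℕ) : List α := S.drop i ++ S.take i

/-- `Z_k(S)`: the string `S` with its length-`k` prefix appended. -/
def zk (S : List α) (k : ℕ) : List α := S ++ S.take k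

/-- `y` is a `k`-mer of `S`: a length-`k` substring of `Z_k(S)`. -/
def IsKmer (S : List α) (k : ℕ) (y : List α) : Prop :=
  y.length = k ∧ y <:+: zk S k

/-- The finite set of `k`-mers of `S`. -/
def kmersF (S : List α) (k : ℕ) : Finset (List α) :=
  ((List.range S.length).map (fun i => ((zk S k).drop i).take k)).toFinset

/-- The number of rotations of `S` having `y` as a prefix. -/
def rotCount (S y : List α) : ℕ :=
  (Finset.filter (fun i => y <+: rot S i) (Finset.range S.length)).card

/-- `y` is a prefix of some rotation of `S`. -/
def IsRotPrefix (S y : List α) : Prop := ∃ i < S.length, y <+: rot S i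

/-- The number of occurrences of `z` as a substring of `w` (counted by start positions). -/
def occCount (z w : List α) : ℕ :=
  (Finset.filter (fun i => z <+: w.drop i) (Finset.range w.length)).card

/-- The multiplicity of the edge `(x, y)` in the order-`k` de Bruijn graph of `S`. -/
def edgeMult (S : List α) (k : ℕ) (x y : List α) : ℕ :=
  (Finset.filter
    (fun i => x <+: (zk S k).drop i ∧ y <+: (zk S k).drop (i + 1))
    (Finset.range S.length)).card

/-- `c` is a Weiner link of `y` (for `|y| < n` this says `c·y` is a prefix of a rotation,
and for `|y| = n` that `c·y[1..n-1]` is; note `y.take (n-1) = y` when `|y| ≤ n - 1`). -/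
def IsWeinerLink (S y : List α) (c : α) : Prop :=
  IsRotPrefix S (c :: y.take (S.length - 1))

/-- `y` has a unique Weiner link. -/
def HasUniqueWeinerLink (S y : List α) : Prop := ∃! c, IsWeinerLink S y c

/-- The weight `w_k(y)`. -/
def wWeight (S : List α) (k : ℕ) (y : List α) : ℕ :=
  if ∃ c, (∀ d, IsWeinerLink S y d ↔ d = c) ∧
      ∀ i < S.length, (c :: y.take (k - 1)) <+: rot S i → (c :: y) <+: rot S i
  then 1 else rotCount S y

/-- The edge `(x,y)` of the order-`k` de Bruijn graph is fusible. -/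
def FusibleEdge (S : List α) (k : ℕ) (x y : List α) : Prop :=
  1 ≤ edgeMult S k x y ∧
  (∀ y', 1 ≤ edgeMult S k x y' → y' = y) ∧
  (∀ x', 1 ≤ edgeMult S k x' y → x' = x)

/-- The multiplicity of `(x,y)` in the edge-reduced de Bruijn graph. -/
def redMult (S : List α) (k : ℕ) (x y : List α) : ℕ :=
  if FusibleEdge S k x y then 1 else edgeMult S k x y

/-- The total edge multiplicity `m_k` of the edge-reduced de Bruijn graph. -/
def mRed (S : List α) (k : ℕ) : ℕ :=
  ∑ p ∈ kmersF S k ×ˢ kmersF S k, redMult S k p.1 p.2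

/-- The rotations of `S` in increasing lexicographic order. -/
def sortedRots (S : List α) : List (List α) :=
  List.insertionSort (· ≤ ·) ((List.range S.length).map (rot S))

/-- `R_i` (0-indexed): the `i`-th rotation of `S` in lexicographic order. -/
def Ro (S : List α) (i : ℕ) : List α := (sortedRots S).getD i []

/-- The Burrows–Wheeler transform: `L[i]` is the last character of `R_i`. -/
def bwtL [Inhabited α] (S : List α) (i : ℕ) : α := (Ro S i).getLast!

/-- The LF-mapping (0-indexed): sends `i` to the `j` with `R_j` the rotation obtained
from `R_i` by moving its last character to the front. -/
def lf (S : List α) (i : ℕ) : ℕ :=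
  (List.range S.length).findIdx
    (fun j => decide (Ro S j = (Ro S i).rotate ((Ro S i).length - 1)))

/-- The inverse LF-mapping (0-indexed). -/
def lfInv (S : List α) (i : ℕ) : ℕ :=
  (List.range S.length).findIdx (fun j => decide (Ro S j = (Ro S i).rotate 1))

/-- `LF^x` for an integer `x` (negative `x` iterates the inverse). -/
def lfPow (S : List α) (x : ℤ) (i : ℕ) : ℕ :=
  if 0 ≤ x then (lf S)^[x.toNat] i else (lfInv S)^[(-x).toNat] i

/-- `⟨w, [i,j]⟩` is a prefix interval of the BWT of `S`. -/
def PrefixIntervalP [Inhabited α] (S : List α) (w i j : ℕ) : Prop :=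
  i ≤ j ∧ j < S.length ∧
  ∀ x : ℤ, -1 ≤ x → x < (w : ℤ) →
    ∀ y, i ≤ y → y ≤ j → bwtL S (lfPow S x y) = bwtL S (lfPow S x i)

/-- `(p 0, …, p (w-1))` is a fusible path in the order-`k` de Bruijn graph of `S`. -/
def FusiblePath (S : List α) (k w : ℕ) (p : ℕ → List α) : Prop :=
  1 ≤ w ∧ (∀ t < w, IsKmer S k (p t)) ∧
  (∀ s < w, ∀ t < w, p s = p t → s = t) ∧
  ∀ t, t + 1 < w → FusibleEdge S k (p t) (p (t + 1))

/-- A maximal fusible path: one that is not a proper consecutive subsequence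
of a longer fusible path. -/
def MaximalFusiblePath (S : List α) (k w : ℕ) (p : ℕ → List α) : Prop :=
  FusiblePath S k w p ∧
  ¬ ∃ (w' : ℕ) (p' : ℕ → List α) (off : ℕ),
      FusiblePath S k w' p' ∧ w < w' ∧ off + w ≤ w' ∧ ∀ t < w, p t = p' (t + off)

theorem rot_eq_rotate (S : List α) {i : ℕ} (hi : i ≤ S.length) : rot S i = S.rotate i :=
  (List.rotate_eq_drop_append_take hi).symm

theorem isRotPrefix_iff_rotate {S y : List α} (hS : S ≠ []) :
    IsRotPrefix S y ↔ ∃ i, y <+: S.rotate i := by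
  constructor
  · rintro ⟨i, hi, h⟩
    exact ⟨i, rot_eq_rotate S hi.le ▸ h⟩
  · rintro ⟨i, h⟩
    have hlt : i % S.length < S.length := Nat.mod_lt _ (List.length_pos_iff.2 hS)
    refine ⟨i % S.length, hlt, ?_⟩
    rwa [rot_eq_rotate S hlt.le, List.rotate_mod]

theorem IsWeinerLink.of_prefix {S y y' : List α} {c : α} (h : y <+: y')
    (hc : IsWeinerLink S y' c) : IsWeinerLink S y c := by
  obtain ⟨i, hi, hp⟩ := hc
  exact ⟨i, hi, ((List.prefix_cons_inj c).2 (h.take _)).trans hp⟩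

theorem IsRotPrefix.exists_isWeinerLink {S y : List α} (h : IsRotPrefix S y) :
    ∃ c, IsWeinerLink S y c := by
  have hS : S ≠ [] := by
    rintro rfl
    obtain ⟨i, hi, -⟩ := h
    simp at hi
  obtain ⟨i, hp⟩ := (isRotPrefix_iff_rotate hS).1 h
  have hne : S.rotate i ≠ [] := by simpa using hS
  refine ⟨(S.rotate i).getLast hne, (isRotPrefix_iff_rotate hS).2 ⟨i + (S.length - 1), ?_⟩⟩
  have hrot : S.rotate (i + (S.length - 1)) =
      (S.rotate i).getLast hne :: (S.rotate i).take (S.length - 1) := by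
    rw [← List.rotate_rotate, List.rotate_eq_drop_append_take (by simp)]
    have hdrop := List.drop_length_sub_one hne
    rw [List.length_rotate] at hdrop
    rw [hdrop, List.singleton_append]
  rw [hrot, List.prefix_cons_inj]
  exact hp.take _

theorem IsRotPrefix.hasUniqueWeinerLink_of_prefix {S y y' : List α} (hy' : IsRotPrefix S y')
    (hp : y <+: y') (hy : HasUniqueWeinerLink S y) : HasUniqueWeinerLink S y' := by
  obtain ⟨c, hc⟩ := hy'.exists_isWeinerLink
  exact ⟨c, hc, fun d hd => hy.unique (hd.of_prefix hp) (hc.of_prefix hp)⟩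

theorem IsRotPrefix.exists_ne_of_not_hasUniqueWeinerLink {S y : List α} (h : IsRotPrefix S y)
    (hy : ¬ HasUniqueWeinerLink S y) :
    ∃ c d, c ≠ d ∧ IsWeinerLink S y c ∧ IsWeinerLink S y d := by
  obtain ⟨c, hc⟩ := h.exists_isWeinerLink
  by_contra! hall
  exact hy ⟨c, hc, fun d hd => by_contra fun hdc => hall d c hdc hd hc⟩

theorem IsWeinerLink.cons_perm {S y : List α} {c : α} (hS : S ≠ []) (hy : y.length = S.length)
    (hc : IsWeinerLink S y c) : (c :: y.take (S.length - 1)).Perm S := by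
  obtain ⟨i, hp⟩ := (isRotPrefix_iff_rotate hS).1 hc
  have hpos := List.length_pos_iff.2 hS
  have heq := hp.eq_of_length (by simp [hy]; omega)
  rw [heq]
  exact List.rotate_perm S i

theorem eq_of_cons_perm_cons {T : List α} {c d : α} (h : (c :: T).Perm (d :: T)) : c = d := by
  by_contra hcd
  have hcount := h.count_eq c
  rw [List.count_cons_self, List.count_cons_of_ne (Ne.symm hcd)] at hcount
  omega

theorem hasUniqueWeinerLink_rot {S : List α} {i : ℕ} (hi : i < S.length) :
    HasUniqueWeinerLink S (rot S i) := by
  have hS : S ≠ [] := List.ne_nil_of_length_pos (by omega)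
  have hlen : (rot S i).length = S.length := by rw [rot_eq_rotate S hi.le, List.length_rotate]
  obtain ⟨c, hc⟩ := IsRotPrefix.exists_isWeinerLink ⟨i, hi, List.prefix_refl (rot S i)⟩
  exact ⟨c, hc, fun d hd =>
    eq_of_cons_perm_cons ((hd.cons_perm hS hlen).trans (hc.cons_perm hS hlen).symm)⟩

/-- on every rotation there is exactly one prefix length `j` at which Weiner
links first become (and afterwards stay) unique. -/
theorem unique_weiner_link_threshold
    (S : List α) (dollar : α)
    (hn : 2 ≤ S.length)
    (hlast : S.getLast? = some dollar)
    (hmin : ∀ c : α, c ≠ dollar → dollar < c)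
    (honce : ∀ i, i < S.length - 1 → S.getD i dollar ≠ dollar) :
    ∀ i, i < S.length →
      ∃! j : ℕ, 1 ≤ j ∧ j ≤ S.length ∧
        HasUniqueWeinerLink S ((rot S i).take j) ∧
        (∀ i', 1 ≤ i' → i' < j →
          ∃ c d, c ≠ d ∧ IsWeinerLink S ((rot S i).take i') c ∧
            IsWeinerLink S ((rot S i).take i') d) ∧
        (∀ y' : List α, IsRotPrefix S y' → (rot S i).take j <+: y' →
          HasUniqueWeinerLink S y') := by
  intro i hi
  have hlen : (rot S i).length = S.length := by rw [rot_eq_rotate S hi.le, List.length_rotate]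
  have hfull : HasUniqueWeinerLink S ((rot S i).take S.length) := by
    rw [List.take_of_length_le hlen.le]
    exact hasUniqueWeinerLink_rot hi
  have hex : ∃ j, 1 ≤ j ∧ HasUniqueWeinerLink S ((rot S i).take j) :=
    ⟨S.length, by omega, hfull⟩
  obtain ⟨hpos, huniq⟩ := Nat.find_spec hex
  refine ⟨Nat.find hex, ⟨hpos, Nat.find_min' hex ⟨by omega, hfull⟩, huniq,
    fun i' hi' hlt => ?_, fun y' hy' hp => hy'.hasUniqueWeinerLink_of_prefix hp huniq⟩, ?_⟩
  · exact IsRotPrefix.exists_ne_of_not_hasUniqueWeinerLink ⟨i, hi, List.take_prefix _ _⟩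
      fun h => Nat.find_min hex hlt ⟨hi', h⟩
  · rintro j ⟨hj, -, hju, hmulti, -⟩
    refine le_antisymm ?_ (Nat.find_min' hex ⟨hj, hju⟩)
    by_contra! hlt
    obtain ⟨c, d, hcd, hc, hd⟩ := hmulti _ hpos hlt
    exact hcd (huniq.unique hc hd)
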